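/- arXiv:2501.12510 — 3 statements merged into one kernel-verified Lean document; each statement's English description precedes it below -/
import Mathlib

section
/- Let J : 𝒜 → ℰ be a pseudofunctor, T a J-relative pseudomonad, (A, (-)^a, â, ã) a T-pseudoalgebra and (B, (-)^b, b̂, b̃) a lax-idempotent T-pseudoalgebra. The forgetful functor from the category of lax morphisms (A, (-)^a, â, ã) → (B, (-)^b, b̂, b̃) and transformations to the hom-category ℰ[A, B], sending (h, h̄) to h and acting as the identity on 2-cells, is fully faithful; in particular every 2-cell in ℰ between (the underlying 1-cells of) such lax morphisms is a transformation. -/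
open CategoryTheory Bicategory

universe w₁ v₁ u₁ w₂ v₂ u₂

section RelPsMnd

variable {𝒜 : Type u₁} [Bicategory.{w₁, v₁} 𝒜] {ℰ : Type u₂} [Bicategory.{w₂, v₂} ℰ]

/-- Precomposition with a fixed 1-cell, as a functor between hom-categories. -/
@[simps]
def precompF {a b : ℰ} (c : ℰ) (f : a ⟶ b) : (b ⟶ c) ⥤ (a ⟶ c) where
  obj g := f ≫ g
  map η := f ◁ η

/-- A pseudomonad relative to a pseudofunctor `J : 𝒜 ⥤ ℰ`, given in extension form:
an object assignment, extension operators, units, and invertible coherence 2-cells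
`mul` (μ), `eta` (η), `theta` (θ) subject to associativity and unit laws. -/
structure RelativePseudomonad (J : Pseudofunctor 𝒜 ℰ) where
  obj : 𝒜 → ℰ
  unit : ∀ X : 𝒜, J.obj X ⟶ obj X
  ext : ∀ {X Y : 𝒜}, (J.obj X ⟶ obj Y) ⥤ (obj X ⟶ obj Y)
  mul : ∀ {X Y Z : 𝒜} (f : J.obj X ⟶ obj Y) (g : J.obj Y ⟶ obj Z),
    ext.obj (f ≫ ext.obj g) ≅ ext.obj f ≫ ext.obj g
  eta : ∀ {X Y : 𝒜} (f : J.obj X ⟶ obj Y), f ≅ unit X ≫ ext.obj f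
  theta : ∀ X : 𝒜, ext.obj (unit X) ≅ 𝟙 (obj X)
  mul_natural : ∀ {X Y Z : 𝒜} {f f' : J.obj X ⟶ obj Y} {g g' : J.obj Y ⟶ obj Z}
    (α : f ⟶ f') (β : g ⟶ g'),
    ext.map (α ▷ ext.obj g ≫ f' ◁ ext.map β) ≫ (mul f' g').hom =
      (mul f g).hom ≫ (ext.map α ▷ ext.obj g ≫ ext.obj f' ◁ ext.map β)
  eta_natural : ∀ {X Y : 𝒜} {f f' : J.obj X ⟶ obj Y} (α : f ⟶ f'),
    α ≫ (eta f').hom = (eta f).hom ≫ unit X ◁ ext.map α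
  assoc : ∀ {W X Y Z : 𝒜} (f : J.obj W ⟶ obj X) (g : J.obj X ⟶ obj Y)
    (h : J.obj Y ⟶ obj Z),
    (mul f (g ≫ ext.obj h)).hom ≫ ext.obj f ◁ (mul g h).hom =
      ext.map (f ◁ (mul g h).hom) ≫ ext.map (α_ f (ext.obj g) (ext.obj h)).inv ≫
        (mul (f ≫ ext.obj g) h).hom ≫ (mul f g).hom ▷ ext.obj h ≫
        (α_ (ext.obj f) (ext.obj g) (ext.obj h)).hom
  unit_law : ∀ {X Y : 𝒜} (f : J.obj X ⟶ obj Y),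
    ext.map (eta f).hom ≫ (mul (unit X) f).hom ≫ (theta X).hom ▷ ext.obj f =
      (λ_ (ext.obj f)).inv

namespace RelativePseudomonad

variable {J : Pseudofunctor 𝒜 ℰ} (T : RelativePseudomonad J)

/-- The data of a pseudoalgebra for a relative pseudomonad on a carrier `C`:
extension operators `ext`, associativity 2-cells `ahat` (â) and unit 2-cells `atil` (ã). -/
structure AlgData (C : ℰ) where
  ext : ∀ (X : 𝒜), (J.obj X ⟶ C) ⥤ (T.obj X ⟶ C)
  ahat : ∀ {X Y : 𝒜} (f : J.obj X ⟶ T.obj Y) (g : J.obj Y ⟶ C),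
    (ext X).obj (f ≫ (ext Y).obj g) ≅ T.ext.obj f ≫ (ext Y).obj g
  atil : ∀ {X : 𝒜} (f : J.obj X ⟶ C), f ≅ T.unit X ≫ (ext X).obj f

/-- The pseudoalgebra axioms. -/
structure AlgData.Laws {C : ℰ} (S : T.AlgData C) : Prop where
  ahat_natural : ∀ {X Y : 𝒜} {f f' : J.obj X ⟶ T.obj Y} {g g' : J.obj Y ⟶ C}
    (α : f ⟶ f') (β : g ⟶ g'),
    (S.ext X).map (α ▷ (S.ext Y).obj g ≫ f' ◁ (S.ext Y).map β) ≫ (S.ahat f' g').hom =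
      (S.ahat f g).hom ≫ (T.ext.map α ▷ (S.ext Y).obj g ≫ T.ext.obj f' ◁ (S.ext Y).map β)
  atil_natural : ∀ {X : 𝒜} {f f' : J.obj X ⟶ C} (α : f ⟶ f'),
    α ≫ (S.atil f').hom = (S.atil f).hom ≫ T.unit X ◁ (S.ext X).map α
  assoc : ∀ {W X Y : 𝒜} (f : J.obj W ⟶ T.obj X) (g : J.obj X ⟶ T.obj Y)
    (h : J.obj Y ⟶ C),
    (S.ahat f (g ≫ (S.ext Y).obj h)).hom ≫ T.ext.obj f ◁ (S.ahat g h).hom =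
      (S.ext W).map (f ◁ (S.ahat g h).hom) ≫
        (S.ext W).map (α_ f (T.ext.obj g) ((S.ext Y).obj h)).inv ≫
        (S.ahat (f ≫ T.ext.obj g) h).hom ≫ (T.mul f g).hom ▷ (S.ext Y).obj h ≫
        (α_ (T.ext.obj f) (T.ext.obj g) ((S.ext Y).obj h)).hom
  unit : ∀ {X : 𝒜} (f : J.obj X ⟶ C),
    (S.ext X).map (S.atil f).hom ≫ (S.ahat (T.unit X) f).hom ≫
      (T.theta X).hom ▷ (S.ext X).obj f = (λ_ ((S.ext X).obj f)).inv

/-- A pseudoalgebra: data together with the laws. -/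
structure Algebra (C : ℰ) extends AlgData T C where
  laws : toAlgData.Laws

/-- The data of the free pseudoalgebra on an object of `𝒜`. -/
@[simps]
def freeAlgData (X : 𝒜) : T.AlgData (T.obj X) where
  ext _ := T.ext
  ahat f g := T.mul f g
  atil f := T.eta f

theorem freeAlgData_laws (X : 𝒜) : (T.freeAlgData X).Laws where
  ahat_natural := T.mul_natural
  atil_natural := T.eta_natural
  assoc := T.assoc
  unit := T.unit_law

/-- The free pseudoalgebra on `X`. -/
def freeAlgebra (X : 𝒜) : T.Algebra (T.obj X) := ⟨T.freeAlgData X, T.freeAlgData_laws X⟩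

variable {T}

/-- The data of a lax morphism of pseudoalgebras: a 1-cell between the carriers
together with the comparison 2-cells `lax`. -/
structure LaxData {C C' : ℰ} (S : T.AlgData C) (S' : T.AlgData C') where
  hom : C ⟶ C'
  lax : ∀ (X : 𝒜) (f : J.obj X ⟶ C),
    (S'.ext X).obj (f ≫ hom) ⟶ (S.ext X).obj f ≫ hom

/-- The axioms for a lax morphism of pseudoalgebras. -/
structure LaxData.IsLaxMorphism {C C' : ℰ} {S : T.AlgData C} {S' : T.AlgData C'}
    (m : LaxData S S') : Prop where
  natural : ∀ {X : 𝒜} {f f' : J.obj X ⟶ C} (α : f ⟶ f'),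
    (S'.ext X).map (α ▷ m.hom) ≫ m.lax X f' = m.lax X f ≫ (S.ext X).map α ▷ m.hom
  unit : ∀ {X : 𝒜} (f : J.obj X ⟶ C),
    (S'.atil (f ≫ m.hom)).hom ≫ T.unit X ◁ m.lax X f =
      (S.atil f).hom ▷ m.hom ≫ (α_ (T.unit X) ((S.ext X).obj f) m.hom).hom
  assoc : ∀ {X Y : 𝒜} (f : J.obj X ⟶ T.obj Y) (g : J.obj Y ⟶ C),
    (S'.ahat f (g ≫ m.hom)).hom ≫ T.ext.obj f ◁ m.lax Y g ≫
        (α_ (T.ext.obj f) ((S.ext Y).obj g) m.hom).inv =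
      (S'.ext X).map (f ◁ m.lax Y g) ≫
        (S'.ext X).map (α_ f ((S.ext Y).obj g) m.hom).inv ≫
        m.lax X (f ≫ (S.ext Y).obj g) ≫ (S.ahat f g).hom ▷ m.hom

/-- Pseudomorphisms are lax morphisms whose comparison 2-cells are invertible. -/
def LaxData.IsPseudoMorphism {C C' : ℰ} {S : T.AlgData C} {S' : T.AlgData C'}
    (m : LaxData S S') : Prop :=
  m.IsLaxMorphism ∧ ∀ (X : 𝒜) (f : J.obj X ⟶ C), IsIso (m.lax X f)

/-- The data of a colax morphism of pseudoalgebras. -/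
structure ColaxData {C C' : ℰ} (S : T.AlgData C) (S' : T.AlgData C') where
  hom : C ⟶ C'
  colax : ∀ (X : 𝒜) (f : J.obj X ⟶ C),
    (S.ext X).obj f ≫ hom ⟶ (S'.ext X).obj (f ≫ hom)

/-- The axioms for a colax morphism of pseudoalgebras. -/
structure ColaxData.IsColaxMorphism {C C' : ℰ} {S : T.AlgData C} {S' : T.AlgData C'}
    (m : ColaxData S S') : Prop where
  natural : ∀ {X : 𝒜} {f f' : J.obj X ⟶ C} (α : f ⟶ f'),
    m.colax X f ≫ (S'.ext X).map (α ▷ m.hom) = (S.ext X).map α ▷ m.hom ≫ m.colax X f'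
  unit : ∀ {X : 𝒜} (f : J.obj X ⟶ C),
    (S.atil f).hom ▷ m.hom ≫ (α_ (T.unit X) ((S.ext X).obj f) m.hom).hom ≫
        T.unit X ◁ m.colax X f =
      (S'.atil (f ≫ m.hom)).hom
  assoc : ∀ {X Y : 𝒜} (f : J.obj X ⟶ T.obj Y) (g : J.obj Y ⟶ C),
    (S.ahat f g).hom ▷ m.hom ≫ (α_ (T.ext.obj f) ((S.ext Y).obj g) m.hom).hom ≫
        T.ext.obj f ◁ m.colax Y g =
      m.colax X (f ≫ (S.ext Y).obj g) ≫
        (S'.ext X).map (α_ f ((S.ext Y).obj g) m.hom).hom ≫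
        (S'.ext X).map (f ◁ m.colax Y g) ≫ (S'.ahat f (g ≫ m.hom)).hom

/-- A 2-cell between (the underlying 1-cells of) two lax morphisms is a transformation. -/
def IsTransformation {C C' : ℰ} {S : T.AlgData C} {S' : T.AlgData C'}
    (m m' : LaxData S S') (α : m.hom ⟶ m'.hom) : Prop :=
  ∀ (X : 𝒜) (f : J.obj X ⟶ C),
    (S'.ext X).map (f ◁ α) ≫ m'.lax X f = m.lax X f ≫ (S.ext X).obj f ◁ α

/-- A 2-cell between (the underlying 1-cells of) two colax morphisms is a transformation. -/
def IsColaxTransformation {C C' : ℰ} {S : T.AlgData C} {S' : T.AlgData C'}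
    (m m' : ColaxData S S') (α : m.hom ⟶ m'.hom) : Prop :=
  ∀ (X : 𝒜) (f : J.obj X ⟶ C),
    (S.ext X).obj f ◁ α ≫ m'.colax X f = m.colax X f ≫ (S'.ext X).map (f ◁ α)

/-- The identity lax morphism data, with the canonical comparison 2-cells
`(1 ∘ f)^a ≅ f^a ≅ 1 ∘ f^a`. -/
@[simps]
def idLaxData {C : ℰ} (S : T.AlgData C) : LaxData S S where
  hom := 𝟙 C
  lax X f := (S.ext X).map (ρ_ f).hom ≫ (ρ_ ((S.ext X).obj f)).inv

/-- The composite of two lax morphism data. -/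
@[simps]
def compLaxData {C C' C'' : ℰ} {S : T.AlgData C} {S' : T.AlgData C'} {S'' : T.AlgData C''}
    (m : LaxData S S') (m' : LaxData S' S'') : LaxData S S'' where
  hom := m.hom ≫ m'.hom
  lax X f :=
    (S''.ext X).map (α_ f m.hom m'.hom).inv ≫ m'.lax X (f ≫ m.hom) ≫
      m.lax X f ▷ m'.hom ≫ (α_ ((S.ext X).obj f) m.hom m'.hom).hom

/-- The identity colax morphism data. -/
@[simps]
def idColaxData {C : ℰ} (S : T.AlgData C) : ColaxData S S where
  hom := 𝟙 C
  colax X f := (ρ_ ((S.ext X).obj f)).hom ≫ (S.ext X).map (ρ_ f).inv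

/-- The composite of two colax morphism data. -/
@[simps]
def compColaxData {C C' C'' : ℰ} {S : T.AlgData C} {S' : T.AlgData C'} {S'' : T.AlgData C''}
    (m : ColaxData S S') (m' : ColaxData S' S'') : ColaxData S S'' where
  hom := m.hom ≫ m'.hom
  colax X f :=
    (α_ ((S.ext X).obj f) m.hom m'.hom).inv ≫ m.colax X f ▷ m'.hom ≫
      m'.colax X (f ≫ m.hom) ≫ (S''.ext X).map (α_ f m.hom m'.hom).hom

/-- Morphisms of pseudoalgebras satisfying a property `P` (e.g. lax morphisms,
pseudomorphisms), which form a category under transformations. -/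
def Mor {C C' : ℰ} (S : T.AlgData C) (S' : T.AlgData C') (P : LaxData S S' → Prop) :=
  { m : LaxData S S' // P m }

instance morCategory {C C' : ℰ} (S : T.AlgData C) (S' : T.AlgData C')
    (P : LaxData S S' → Prop) : Category (Mor S S' P) where
  Hom m m' := { α : m.val.hom ⟶ m'.val.hom // IsTransformation m.val m'.val α }
  id m := ⟨𝟙 m.val.hom, by intro X f; simp⟩
  comp {m m' m''} α β := ⟨α.val ≫ β.val, by
    intro X f
    have hα := α.property X f
    have hβ := β.property X f
    simp only [Bicategory.whiskerLeft_comp, Functor.map_comp, Category.assoc]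
    rw [hβ, ← Category.assoc, hα, Category.assoc]⟩
  id_comp := by intros; apply Subtype.ext; simp
  comp_id := by intros; apply Subtype.ext; simp
  assoc := by intros; apply Subtype.ext; simp

/-- The forgetful functor from a category of morphisms of pseudoalgebras and
transformations to the corresponding hom-category of `ℰ`. -/
@[simps]
def morForget {C C' : ℰ} (S : T.AlgData C) (S' : T.AlgData C') (P : LaxData S S' → Prop) :
    Mor S S' P ⥤ (C ⟶ C') where
  obj m := m.val.hom
  map α := α.val

/-- A pseudoalgebra is lax-idempotent when its unit 2-cells `atil` exhibit the unit of
an adjunction between extension and precomposition with the unit of the pseudomonad. -/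
def IsLaxIdempotent {C : ℰ} (S : T.AlgData C) : Prop :=
  ∀ X : 𝒜, ∃ adj : S.ext X ⊣ precompF C (T.unit X),
    ∀ f : J.obj X ⟶ C, adj.unit.app f = (S.atil f).hom

section Mates

variable {C C' : ℰ} {S : T.AlgData C} {S' : T.AlgData C'} {l : C ⟶ C'} {r : C' ⟶ C}

/-- The 2-cell `f ⇒ rℓf` obtained by whiskering the unit of an adjunction. -/
def nuW (adj : Bicategory.Adjunction l r) {a : ℰ} (f : a ⟶ C) : f ⟶ (f ≫ l) ≫ r :=
  (ρ_ f).inv ≫ f ◁ adj.unit ≫ (α_ f l r).inv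

/-- The 2-cell `ℓrg ⇒ g` obtained by whiskering the counit of an adjunction. -/
def epsW (adj : Bicategory.Adjunction l r) {a : ℰ} (g : a ⟶ C') : (g ≫ r) ≫ l ⟶ g :=
  (α_ g r l).hom ≫ g ◁ adj.counit ≫ (ρ_ g).hom

/-- The colax morphism structure on a left adjoint `ℓ` obtained as the mate of a lax
morphism structure on its right adjoint `r`. -/
def colaxMate (adj : Bicategory.Adjunction l r)
    (rl : ∀ (X : 𝒜) (g : J.obj X ⟶ C'), (S.ext X).obj (g ≫ r) ⟶ (S'.ext X).obj g ≫ r) :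
    ∀ (X : 𝒜) (f : J.obj X ⟶ C), (S.ext X).obj f ≫ l ⟶ (S'.ext X).obj (f ≫ l) :=
  fun X f =>
    (S.ext X).map (nuW adj f) ▷ l ≫ rl X (f ≫ l) ▷ l ≫
      (α_ ((S'.ext X).obj (f ≫ l)) r l).hom ≫ (S'.ext X).obj (f ≫ l) ◁ adj.counit ≫
      (ρ_ ((S'.ext X).obj (f ≫ l))).hom

/-- The lax morphism structure on a right adjoint `r` obtained as the mate of a colax
morphism structure on its left adjoint `ℓ`. -/
def laxMate (adj : Bicategory.Adjunction l r)
    (lc : ∀ (X : 𝒜) (f : J.obj X ⟶ C), (S.ext X).obj f ≫ l ⟶ (S'.ext X).obj (f ≫ l)) :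
    ∀ (X : 𝒜) (g : J.obj X ⟶ C'), (S.ext X).obj (g ≫ r) ⟶ (S'.ext X).obj g ≫ r :=
  fun X g =>
    (ρ_ ((S.ext X).obj (g ≫ r))).inv ≫ (S.ext X).obj (g ≫ r) ◁ adj.unit ≫
      (α_ ((S.ext X).obj (g ≫ r)) l r).inv ≫ lc X (g ≫ r) ▷ r ≫
      (S'.ext X).map (epsW adj g) ▷ r

end Mates

end RelativePseudomonad

end RelPsMnd

namespace RelativePseudomonad

variable {𝒜 : Type u₁} [Bicategory.{w₁, v₁} 𝒜] {ℰ : Type u₂} [Bicategory.{w₂, v₂} ℰ]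
  {J : Pseudofunctor 𝒜 ℰ} {T : RelativePseudomonad J}

/-- For a lax-idempotent pseudoalgebra, 2-cells out of an extension are determined by their
restriction along the unit. -/
theorem IsLaxIdempotent.hom_ext {C : ℰ} {S : T.AlgData C} (hS : IsLaxIdempotent S) {X : 𝒜}
    {f : J.obj X ⟶ C} {g : T.obj X ⟶ C} {β γ : (S.ext X).obj f ⟶ g}
    (h : (S.atil f).hom ≫ T.unit X ◁ β = (S.atil f).hom ≫ T.unit X ◁ γ) : β = γ := by
  obtain ⟨adj, hadj⟩ := hS X
  apply (adj.homEquiv f g).injective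
  rw [adj.homEquiv_unit, adj.homEquiv_unit, hadj]
  exact h

/-- Any 2-cell between 1-cells into a lax-idempotent pseudoalgebra, equipped with comparison
2-cells compatible with the units, is a transformation. -/
theorem isTransformation_of_laxIdempotent {C C' : ℰ} {S : T.AlgData C} {S' : T.AlgData C'}
    (hS' : S'.Laws) (hLI : IsLaxIdempotent S') {m m' : LaxData S S'}
    (hm : ∀ {X : 𝒜} (f : J.obj X ⟶ C), (S'.atil (f ≫ m.hom)).hom ≫ T.unit X ◁ m.lax X f =
      (S.atil f).hom ▷ m.hom ≫ (α_ (T.unit X) ((S.ext X).obj f) m.hom).hom)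
    (hm' : ∀ {X : 𝒜} (f : J.obj X ⟶ C), (S'.atil (f ≫ m'.hom)).hom ≫ T.unit X ◁ m'.lax X f =
      (S.atil f).hom ▷ m'.hom ≫ (α_ (T.unit X) ((S.ext X).obj f) m'.hom).hom)
    (α : m.hom ⟶ m'.hom) : IsTransformation m m' α := by
  intro X f
  apply hLI.hom_ext
  rw [Bicategory.whiskerLeft_comp, Bicategory.whiskerLeft_comp,
    ← Category.assoc, ← hS'.atil_natural, Category.assoc, hm', ← Category.assoc,
    whisker_exchange, Category.assoc, ← Category.assoc (S'.atil _).hom, hm, Category.assoc,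
    comp_whiskerLeft]
  simp

end RelativePseudomonad

open RelativePseudomonad in
/-- If `(B, (-)^b, b̂, b̃)` is a lax-idempotent `T`-pseudoalgebra and
`(A, (-)^a, â, ã)` is any `T`-pseudoalgebra, then the forgetful functor from the category
of lax morphisms `A → B` and transformations to the hom-category `ℰ[A, B]` is fully
faithful; in particular every 2-cell of `ℰ` between the underlying 1-cells of two lax
morphisms is a transformation. -/
theorem forget_fullyFaithful_of_laxIdempotent
    {𝒜 : Type u₁} [Bicategory.{w₁, v₁} 𝒜] {ℰ : Type u₂} [Bicategory.{w₂, v₂} ℰ]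
    {J : Pseudofunctor 𝒜 ℰ} (T : RelativePseudomonad J)
    {C₀ C : ℰ} (SA : T.AlgData C₀) (SB : T.AlgData C)
    (hA : SA.Laws) (hB : SB.Laws) (hLI : IsLaxIdempotent SB) :
    (morForget SA SB (fun m => m.IsLaxMorphism)).Full ∧
    (morForget SA SB (fun m => m.IsLaxMorphism)).Faithful ∧
    (∀ m m' : LaxData SA SB, m.IsLaxMorphism → m'.IsLaxMorphism →
      ∀ α : m.hom ⟶ m'.hom, IsTransformation m m' α) := by
  have key : ∀ m m' : LaxData SA SB, m.IsLaxMorphism → m'.IsLaxMorphism →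
      ∀ α : m.hom ⟶ m'.hom, IsTransformation m m' α :=
    fun m m' hm hm' α => isTransformation_of_laxIdempotent hB hLI hm.unit hm'.unit α
  exact ⟨⟨fun {m m'} α => ⟨⟨α, key m.val m'.val m.property m'.property α⟩, rfl⟩⟩,
    ⟨fun h => Subtype.ext h⟩, key⟩
end

section
/- Let J : 𝒜 → ℰ be a pseudofunctor and T a J-relative pseudomonad. For every object A of ℰ there is a bijection between left extension T-pseudoalgebra structures on A and lax-idempotent T-pseudoalgebra structures on A: given a left extension T-pseudoalgebra (A, (-)^a, ã), defining â_{g,f} : (g^a f)^a ⇒ g^a f* to be the unique 2-cell induced by the universal property of the left extension (g^a f)^a from the 2-cell g^a η_f : g^a f ⇒ (g^a f*) i_X yields a T-pseudoalgebra (A, (-)^a, â, ã) which is lax-idempotent, and this assignment is a bijection onto the lax-idempotent structures. -/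
open CategoryTheory Bicategory

universe w₁ v₁ u₁ w₂ v₂ u₂

namespace RelativePseudomonad

variable {𝒜 : Type u₁} [Bicategory.{w₁, v₁} 𝒜] {ℰ : Type u₂} [Bicategory.{w₂, v₂} ℰ]

/-- A 2-cell `φ : f ⟶ i ≫ g` exhibits `g` as a left extension of `f` along `i` when
pasting with `φ` is a bijection between 2-cells out of `g` and 2-cells out of `f`. -/
def ExhibitsLeftExt {a b c : ℰ} (i : a ⟶ b) (f : a ⟶ c) (g : b ⟶ c) (φ : f ⟶ i ≫ g) :
    Prop :=
  ∀ h : b ⟶ c, Function.Bijective (fun τ : g ⟶ h => φ ≫ i ◁ τ)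

variable {J : Pseudofunctor 𝒜 ℰ} (T : RelativePseudomonad J)

/-- A left extension pseudoalgebra for a relative pseudomonad: 1-cells `f^a` and
invertible 2-cells `ã_f : f ≅ f^a ∘ i_X` exhibiting `f^a` as the left extension of `f`
along `i_X`, such that moreover `g^a η_f` exhibits `g^a f^*` as the left extension of
`g^a f` along `i_X`. -/
structure LeftExtAlg (C : ℰ) where
  ext1 : ∀ (X : 𝒜) (f : J.obj X ⟶ C), T.obj X ⟶ C
  atil : ∀ {X : 𝒜} (f : J.obj X ⟶ C), f ≅ T.unit X ≫ ext1 X f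
  isLeftExt : ∀ (X : 𝒜) (f : J.obj X ⟶ C),
    ExhibitsLeftExt (T.unit X) f (ext1 X f) (atil f).hom
  ext_isLeftExt : ∀ {X Y : 𝒜} (f : J.obj X ⟶ T.obj Y) (g : J.obj Y ⟶ C),
    ExhibitsLeftExt (T.unit X) (f ≫ ext1 Y g) (T.ext.obj f ≫ ext1 Y g)
      ((T.eta f).hom ▷ ext1 Y g ≫ (α_ (T.unit X) (T.ext.obj f) (ext1 Y g)).hom)

end RelativePseudomonad

namespace RelativePseudomonad

section Coherence

variable {𝒜 : Type u₁} [Bicategory.{w₁, v₁} 𝒜] {ℰ : Type u₂} [Bicategory.{w₂, v₂} ℰ]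
  {J : Pseudofunctor 𝒜 ℰ} {T : RelativePseudomonad J}

/-- The extension operator of a pseudoalgebra is faithful, since `f ≅ f^a ∘ i` naturally. -/
theorem AlgData.Laws.ext_map_injective {C : ℰ} {S : T.AlgData C} (hS : S.Laws) {X : 𝒜}
    {f f' : J.obj X ⟶ C} {α β : f ⟶ f'} (h : (S.ext X).map α = (S.ext X).map β) : α = β := by
  rw [← cancel_mono (S.atil f').hom, hS.atil_natural, hS.atil_natural, h]

/-- The multiplication 2-cells `â` of a pseudoalgebra are compatible with the units. -/
theorem AlgData.Laws.atil_ahat {C : ℰ} {S : T.AlgData C} (hS : S.Laws) {X Y : 𝒜}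
    (f : J.obj X ⟶ T.obj Y) (g : J.obj Y ⟶ C) :
    (S.atil (f ≫ (S.ext Y).obj g)).hom ≫ T.unit X ◁ (S.ahat f g).hom =
      (T.eta f).hom ▷ (S.ext Y).obj g ≫
        (α_ (T.unit X) (T.ext.obj f) ((S.ext Y).obj g)).hom := by
  apply hS.ext_map_injective
  have hassoc := hS.assoc (T.unit X) f g
  have hunit := hS.unit (f ≫ (S.ext Y).obj g)
  have hunitT := T.unit_law f
  have hnat := hS.ahat_natural (T.eta f).hom (𝟙 g)
  rw [(S.ext Y).map_id, whiskerLeft_id, whiskerLeft_id, Category.comp_id, Category.comp_id] at hnat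
  rw [← cancel_mono ((S.ext X).map (α_ (T.unit X) (T.ext.obj f) ((S.ext Y).obj g)).inv ≫
        (S.ahat (T.unit X ≫ T.ext.obj f) g).hom ≫ (T.mul (T.unit X) f).hom ▷ (S.ext Y).obj g ≫
        (α_ (T.ext.obj (T.unit X)) (T.ext.obj f) ((S.ext Y).obj g)).hom ≫
        (T.theta X).hom ▷ (T.ext.obj f ≫ (S.ext Y).obj g))]
  trans (S.ahat f g).hom ≫ (λ_ (T.ext.obj f ≫ (S.ext Y).obj g)).inv
  · have h1 := congrArg (fun t => (S.ext X).map (S.atil (f ≫ (S.ext Y).obj g)).hom ≫ t ≫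
      (T.theta X).hom ▷ (T.ext.obj f ≫ (S.ext Y).obj g)) hassoc
    simp only [Category.assoc] at h1
    simp only [Functor.map_comp, Category.assoc]
    rw [← h1, whisker_exchange, reassoc_of% hunit]
    simp
  · simp only [Functor.map_comp, Category.assoc]
    rw [← Functor.map_comp_assoc _ (α_ _ _ _).hom, Iso.hom_inv_id, (S.ext X).map_id,
      Category.id_comp, reassoc_of% hnat]
    have h2 := congrArg (fun t => t ▷ (S.ext Y).obj g ≫ (α_ _ _ _).hom) hunitT
    simp only [comp_whiskerRight, Category.assoc, associator_naturality_left] at h2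
    rw [h2]
    simp

/-- The multiplication of a relative pseudomonad is compatible with the units. -/
theorem eta_mul {X Y Z : 𝒜} (f : J.obj X ⟶ T.obj Y) (g : J.obj Y ⟶ T.obj Z) :
    (T.eta (f ≫ T.ext.obj g)).hom ≫ T.unit X ◁ (T.mul f g).hom =
      (T.eta f).hom ▷ T.ext.obj g ≫ (α_ (T.unit X) (T.ext.obj f) (T.ext.obj g)).hom :=
  (T.freeAlgData_laws Z).atil_ahat f g

/-- Whiskering with a 1-cell isomorphic to an identity is faithful. -/
theorem whiskerRight_injective_of_iso_id {a b : ℰ} {k : b ⟶ b} (e : k ≅ 𝟙 b) {f g : a ⟶ b}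
    {α β : f ⟶ g} (h : α ▷ k = β ▷ k) : α = β := by
  have h' : α ▷ 𝟙 b = β ▷ 𝟙 b := by
    rw [← cancel_epi (f ◁ e.hom), whisker_exchange, whisker_exchange, h]
  simpa using h'

/-- The multiplication with a unit is the canonical 2-cell induced by `θ`. -/
theorem mul_theta {X Y : 𝒜} (f : J.obj X ⟶ T.obj Y) :
    (T.mul f (T.unit Y)).hom ≫ T.ext.obj f ◁ (T.theta Y).hom =
      T.ext.map (f ◁ (T.theta Y).hom) ≫ T.ext.map (ρ_ f).hom ≫ (ρ_ (T.ext.obj f)).inv := by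
  have key : T.ext.map ((ρ_ f).inv ≫ f ◁ (T.theta Y).inv) ≫ (T.mul f (T.unit Y)).hom ≫
      T.ext.obj f ◁ (T.theta Y).hom = (ρ_ (T.ext.obj f)).inv := by
    suffices H : ∀ i : J.obj Y ⟶ T.obj Y, (T.ext.map ((ρ_ f).inv ≫ f ◁ (T.theta Y).inv) ≫
        (T.mul f (T.unit Y)).hom ≫ T.ext.obj f ◁ (T.theta Y).hom) ▷ T.ext.obj i =
        (ρ_ (T.ext.obj f)).inv ▷ T.ext.obj i from
      whiskerRight_injective_of_iso_id (T.theta Y) (H (T.unit Y))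
    intro i
    have hassoc := T.assoc f (T.unit Y) i
    have hunit := T.unit_law i
    have hunit' : T.ext.map (T.eta i).hom ≫ (T.mul (T.unit Y) i).hom =
        (λ_ (T.ext.obj i)).inv ≫ (T.theta Y).inv ▷ T.ext.obj i := by
      rw [← hunit]; simp [← comp_whiskerRight]
    have hnat := T.mul_natural (𝟙 f) (T.eta i).hom
    have hnat' := T.mul_natural ((ρ_ f).inv ≫ f ◁ (T.theta Y).inv) (𝟙 i)
    rw [T.ext.map_id, id_whiskerRight, id_whiskerRight, Category.id_comp, Category.id_comp]
      at hnat
    rw [T.ext.map_id, whiskerLeft_id, whiskerLeft_id, Category.comp_id, Category.comp_id]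
      at hnat'
    have h1 := congrArg (fun t => T.ext.map (f ◁ T.ext.map (T.eta i).hom) ≫ t ≫
      T.ext.obj f ◁ ((T.theta Y).hom ▷ T.ext.obj i)) hassoc
    simp only [Category.assoc] at h1
    rw [reassoc_of% hnat, ← whiskerLeft_comp, ← whiskerLeft_comp, hunit,
      ← Functor.map_comp_assoc, ← whiskerLeft_comp, hunit', ← Functor.map_comp_assoc] at h1
    have h2 : f ◁ ((λ_ (T.ext.obj i)).inv ≫ (T.theta Y).inv ▷ T.ext.obj i) ≫
        (α_ f (T.ext.obj (T.unit Y)) (T.ext.obj i)).inv =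
        ((ρ_ f).inv ≫ f ◁ (T.theta Y).inv) ▷ T.ext.obj i := by
      simp
    rw [h2, reassoc_of% hnat', cancel_epi] at h1
    rw [← cancel_mono (α_ _ _ _).hom]
    simpa using h1.symm
  rw [← key, ← Functor.map_comp_assoc, ← Functor.map_comp_assoc]
  simp [← whiskerLeft_comp]

/-- The 2-cells `η` and `θ` of a relative pseudomonad satisfy the triangle law. -/
theorem eta_theta (X : 𝒜) :
    (T.eta (T.unit X)).hom ≫ T.unit X ◁ (T.theta X).hom = (ρ_ (T.unit X)).inv := by
  rw [← cancel_mono (ρ_ (T.unit X)).hom, Iso.inv_hom_id]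
  apply (T.freeAlgData_laws X).ext_map_injective
  have h := T.mul_theta (T.unit X)
  have hunit := T.unit_law (T.unit X)
  have hexch : T.ext.obj (T.unit X) ◁ (T.theta X).hom ≫ (ρ_ (T.ext.obj (T.unit X))).hom =
      (T.theta X).hom ▷ T.ext.obj (T.unit X) ≫ (λ_ (T.ext.obj (T.unit X))).hom := by
    rw [← cancel_mono (T.theta X).hom]
    have := whisker_exchange (T.theta X).hom (T.theta X).hom
    simp only [Category.assoc, ← leftUnitor_naturality, ← rightUnitor_naturality]
    rw [← reassoc_of% this, unitors_equal]
  rw [← cancel_mono (ρ_ (T.ext.obj (T.unit X))).hom] at h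
  simp only [Category.assoc, Iso.inv_hom_id, Category.comp_id, hexch] at h
  change T.ext.map _ = T.ext.map _
  simp only [Functor.map_comp, Category.assoc]
  rw [← h, reassoc_of% hunit]
  simp

end Coherence

section LeftExt

variable {𝒜 : Type u₁} [Bicategory.{w₁, v₁} 𝒜] {ℰ : Type u₂} [Bicategory.{w₂, v₂} ℰ]

namespace ExhibitsLeftExt

variable {a b c : ℰ} {i : a ⟶ b} {f : a ⟶ c} {g : b ⟶ c} {φ : f ⟶ i ≫ g}

/-- The 2-cell out of a left extension induced by its universal property. -/
noncomputable def desc (H : ExhibitsLeftExt i f g φ) {h : b ⟶ c} (ψ : f ⟶ i ≫ h) : g ⟶ h :=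
  ((H h).2 ψ).choose

@[simp]
theorem fac (H : ExhibitsLeftExt i f g φ) {h : b ⟶ c} (ψ : f ⟶ i ≫ h) :
    φ ≫ i ◁ H.desc ψ = ψ :=
  ((H h).2 ψ).choose_spec

@[simp]
theorem fac_assoc (H : ExhibitsLeftExt i f g φ) {h : b ⟶ c} (ψ : f ⟶ i ≫ h) {k : a ⟶ c}
    (χ : i ≫ h ⟶ k) : φ ≫ i ◁ H.desc ψ ≫ χ = ψ ≫ χ := by
  rw [← Category.assoc, H.fac]

theorem hom_ext (H : ExhibitsLeftExt i f g φ) {h : b ⟶ c} {σ τ : g ⟶ h}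
    (w : φ ≫ i ◁ σ = φ ≫ i ◁ τ) : σ = τ :=
  (H h).1 w

/-- Two left extensions of the same 1-cell are isomorphic. -/
@[simps]
noncomputable def uniqueIso (H : ExhibitsLeftExt i f g φ) {g' : b ⟶ c} {φ' : f ⟶ i ≫ g'}
    (H' : ExhibitsLeftExt i f g' φ') : g ≅ g' where
  hom := H.desc φ'
  inv := H'.desc φ
  hom_inv_id := H.hom_ext (by simp)
  inv_hom_id := H'.hom_ext (by simp)

/-- Left extensions are stable under isomorphism of the extending 1-cell. -/
theorem comp_iso (H : ExhibitsLeftExt i f g φ) {g' : b ⟶ c} (e : g ≅ g') :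
    ExhibitsLeftExt i f g' (φ ≫ i ◁ e.hom) := by
  refine fun h => ⟨fun σ τ w => ?_, fun ψ => ⟨e.inv ≫ H.desc ψ, ?_⟩⟩
  · rw [← cancel_epi e.hom]
    exact H.hom_ext (by simpa using w)
  · simp [← whiskerLeft_comp_assoc]

end ExhibitsLeftExt

end LeftExt

section Correspondence

variable {𝒜 : Type u₁} [Bicategory.{w₁, v₁} 𝒜] {ℰ : Type u₂} [Bicategory.{w₂, v₂} ℰ]
  {J : Pseudofunctor 𝒜 ℰ} {T : RelativePseudomonad J} {C : ℰ}

namespace LeftExtAlg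

variable (L : T.LeftExtAlg C)

/-- The action on 2-cells of the extension operator of a left extension pseudoalgebra. -/
noncomputable def map {X : 𝒜} {f f' : J.obj X ⟶ C} (α : f ⟶ f') : L.ext1 X f ⟶ L.ext1 X f' :=
  (L.isLeftExt X f).desc (α ≫ (L.atil f').hom)

/-- The 2-cell `â` of a left extension pseudoalgebra, whose transpose is `g^a η_f`. -/
noncomputable def ahat {X Y : 𝒜} (f : J.obj X ⟶ T.obj Y) (g : J.obj Y ⟶ C) :
    L.ext1 X (f ≫ L.ext1 Y g) ≅ T.ext.obj f ≫ L.ext1 Y g :=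
  (L.isLeftExt _ _).uniqueIso (L.ext_isLeftExt f g)

@[simp]
theorem atil_map {X : 𝒜} {f f' : J.obj X ⟶ C} (α : f ⟶ f') :
    (L.atil f).hom ≫ T.unit X ◁ L.map α = α ≫ (L.atil f').hom := by
  simp [map]

@[simp]
theorem atil_map_assoc {X : 𝒜} {f f' k : J.obj X ⟶ C} (α : f ⟶ f')
    (χ : T.unit X ≫ L.ext1 X f' ⟶ k) :
    (L.atil f).hom ≫ T.unit X ◁ L.map α ≫ χ = α ≫ (L.atil f').hom ≫ χ := by
  simp [map]

@[simp]
theorem atil_ahat {X Y : 𝒜} (f : J.obj X ⟶ T.obj Y) (g : J.obj Y ⟶ C) :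
    (L.atil (f ≫ L.ext1 Y g)).hom ≫ T.unit X ◁ (L.ahat f g).hom =
      (T.eta f).hom ▷ L.ext1 Y g ≫ (α_ (T.unit X) (T.ext.obj f) (L.ext1 Y g)).hom := by
  simp [ahat]

@[simp]
theorem atil_ahat_assoc {X Y : 𝒜} (f : J.obj X ⟶ T.obj Y) (g : J.obj Y ⟶ C)
    {k : J.obj X ⟶ C} (χ : T.unit X ≫ T.ext.obj f ≫ L.ext1 Y g ⟶ k) :
    (L.atil (f ≫ L.ext1 Y g)).hom ≫ T.unit X ◁ (L.ahat f g).hom ≫ χ =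
      (T.eta f).hom ▷ L.ext1 Y g ≫ (α_ (T.unit X) (T.ext.obj f) (L.ext1 Y g)).hom ≫ χ := by
  simp [ahat]

theorem ahat_natural {X Y : 𝒜} {f f' : J.obj X ⟶ T.obj Y} {g g' : J.obj Y ⟶ C}
    (α : f ⟶ f') (β : g ⟶ g') :
    L.map (α ▷ L.ext1 Y g ≫ f' ◁ L.map β) ≫ (L.ahat f' g').hom =
      (L.ahat f g).hom ≫
        (T.ext.map α ▷ L.ext1 Y g ≫ T.ext.obj f' ◁ L.map β) := by
  apply (L.isLeftExt _ _).hom_ext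
  have h := congrArg (fun t => t ▷ L.ext1 Y g ≫ (α_ _ _ _).hom) (T.eta_natural α)
  simp only [comp_whiskerRight, whisker_assoc, Category.assoc, Iso.inv_hom_id,
    Category.comp_id] at h
  simp [whisker_exchange_assoc, reassoc_of% h]

theorem ahat_assoc {W X Y : 𝒜} (f : J.obj W ⟶ T.obj X) (g : J.obj X ⟶ T.obj Y)
    (h : J.obj Y ⟶ C) :
    (L.ahat f (g ≫ L.ext1 Y h)).hom ≫ T.ext.obj f ◁ (L.ahat g h).hom =
      L.map (f ◁ (L.ahat g h).hom) ≫
        L.map (α_ f (T.ext.obj g) (L.ext1 Y h)).inv ≫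
        (L.ahat (f ≫ T.ext.obj g) h).hom ≫ (T.mul f g).hom ▷ L.ext1 Y h ≫
        (α_ (T.ext.obj f) (T.ext.obj g) (L.ext1 Y h)).hom := by
  apply (L.isLeftExt _ _).hom_ext
  have h' := congrArg (fun t => t ▷ L.ext1 Y h ≫ (α_ _ _ _).hom) (T.eta_mul f g)
  simp only [comp_whiskerRight, whisker_assoc, Category.assoc, Iso.inv_hom_id,
    Category.comp_id] at h'
  have hexch := whisker_exchange (T.eta f).hom (L.ahat g h).hom =≫ (α_ _ _ _).hom
  simp only [comp_whiskerLeft, whiskerRight_comp, Category.assoc, Iso.inv_hom_id,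
    Category.comp_id] at hexch
  simp [reassoc_of% h', hexch]

theorem ahat_unit {X : 𝒜} (f : J.obj X ⟶ C) :
    L.map (L.atil f).hom ≫ (L.ahat (T.unit X) f).hom ≫
      (T.theta X).hom ▷ L.ext1 X f = (λ_ (L.ext1 X f)).inv := by
  apply (L.isLeftExt _ _).hom_ext
  have h := congrArg (fun t => t ▷ L.ext1 X f ≫ (α_ _ _ _).hom) (T.eta_theta X)
  simp only [comp_whiskerRight, whisker_assoc, Category.assoc, Iso.inv_hom_id,
    Category.comp_id] at h
  simp [h]

/-- The extension operator of a left extension pseudoalgebra, as a functor. -/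
noncomputable def extFunctor (X : 𝒜) : (J.obj X ⟶ C) ⥤ (T.obj X ⟶ C) where
  obj := L.ext1 X
  map := L.map
  map_id f := (L.isLeftExt X f).hom_ext (by simp)
  map_comp {f _ _} α β := (L.isLeftExt X f).hom_ext (by simp)

/-- The pseudoalgebra data induced by a left extension pseudoalgebra. -/
noncomputable def toAlgData : T.AlgData C where
  ext := L.extFunctor
  ahat := L.ahat
  atil := L.atil

theorem toAlgData_laws : L.toAlgData.Laws where
  ahat_natural := L.ahat_natural
  atil_natural α := (L.atil_map α).symm
  assoc := L.ahat_assoc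
  unit := L.ahat_unit

/-- The extension functor is left adjoint to precomposition with the unit. -/
noncomputable def adjunction (X : 𝒜) : L.extFunctor X ⊣ precompF C (T.unit X) where
  unit :=
    { app := fun f => (L.atil f).hom
      naturality := fun _ _ α => (L.atil_map α).symm }
  counit :=
    { app := fun h => (L.isLeftExt X (T.unit X ≫ h)).desc (𝟙 _)
      naturality := fun h h' α => by
        change L.map (T.unit X ◁ α) ≫ (L.isLeftExt X (T.unit X ≫ h')).desc (𝟙 _) =
          (L.isLeftExt X (T.unit X ≫ h)).desc (𝟙 _) ≫ α
        exact (L.isLeftExt X _).hom_ext (by simp) }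
  left_triangle_components f := by
    change L.map (L.atil f).hom ≫ (L.isLeftExt X (T.unit X ≫ L.ext1 X f)).desc (𝟙 _) =
      𝟙 (L.ext1 X f)
    exact (L.isLeftExt X f).hom_ext (by simp)
  right_triangle_components h := (L.isLeftExt X (T.unit X ≫ h)).fac (𝟙 _)

theorem toAlgData_isLaxIdempotent : IsLaxIdempotent L.toAlgData :=
  fun X => ⟨L.adjunction X, fun _ => rfl⟩

end LeftExtAlg

theorem IsLaxIdempotent.exhibitsLeftExt {S : T.AlgData C} (hS : IsLaxIdempotent S) (X : 𝒜)
    (f : J.obj X ⟶ C) :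
    ExhibitsLeftExt (T.unit X) f ((S.ext X).obj f) (S.atil f).hom := by
  obtain ⟨adj, hadj⟩ := hS X
  intro h
  have hb := (adj.homEquiv f h).bijective
  have he : ⇑(adj.homEquiv f h) = fun τ => (S.atil f).hom ≫ T.unit X ◁ τ := by
    funext τ
    rw [Adjunction.homEquiv_unit, hadj]
    rfl
  rwa [he] at hb

/-- The left extension pseudoalgebra underlying a lax-idempotent pseudoalgebra. -/
def AlgData.toLeftExtAlg (S : T.AlgData C) (hS : S.Laws) (hS' : IsLaxIdempotent S) :
    T.LeftExtAlg C where
  ext1 X := (S.ext X).obj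
  atil f := S.atil f
  isLeftExt := hS'.exhibitsLeftExt
  ext_isLeftExt f g := by
    rw [← hS.atil_ahat]
    exact (hS'.exhibitsLeftExt _ _).comp_iso _

theorem LeftExtAlg.ext_of_heq {L L' : T.LeftExtAlg C}
    (h : ∀ (X : 𝒜) (f : J.obj X ⟶ C), L.ext1 X f = L'.ext1 X f)
    (h' : ∀ (X : 𝒜) (f : J.obj X ⟶ C), HEq (L.atil f) (L'.atil f)) : L = L' := by
  obtain ⟨e, t, _, _⟩ := L
  obtain ⟨e', t', _, _⟩ := L'
  obtain rfl : e = e' := funext fun X => funext fun f => h X f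
  obtain rfl : @t = @t' := funext fun X => funext fun f => eq_of_heq (h' X f)
  rfl

theorem LeftExtAlg.eq_extFunctor (L : T.LeftExtAlg C) {X : 𝒜}
    (E : (J.obj X ⟶ C) ⥤ (T.obj X ⟶ C)) (t : ∀ f : J.obj X ⟶ C, f ≅ T.unit X ≫ E.obj f)
    (hnat : ∀ {f f' : J.obj X ⟶ C} (α : f ⟶ f'),
      α ≫ (t f').hom = (t f).hom ≫ T.unit X ◁ E.map α)
    (hobj : ∀ f, E.obj f = L.ext1 X f) (ht : ∀ f, HEq (t f) (L.atil f)) :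
    E = L.extFunctor X := by
  obtain ⟨obj, map, hid, hcomp⟩ := E
  obtain rfl : obj = L.ext1 X := funext hobj
  obtain rfl : t = fun f => L.atil f := funext fun f => eq_of_heq (ht f)
  obtain rfl : @map = fun {f f'} => L.map (f := f) (f' := f') := by
    funext f f' α
    exact (L.isLeftExt X f).hom_ext ((hnat α).symm.trans (L.atil_map α).symm)
  rfl

/-- A pseudoalgebra whose extensions and units are those of a left extension pseudoalgebra
`L` is the one induced by `L`. -/
theorem LeftExtAlg.eq_toAlgData (L : T.LeftExtAlg C) {S : T.AlgData C} (hS : S.Laws)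
    (hobj : ∀ (X : 𝒜) (f : J.obj X ⟶ C), (S.ext X).obj f = L.ext1 X f)
    (hatil : ∀ (X : 𝒜) (f : J.obj X ⟶ C), HEq (S.atil f) (L.atil f)) :
    S = L.toAlgData := by
  obtain ⟨E, ahat, atil⟩ := S
  obtain rfl : E = L.extFunctor :=
    funext fun X => L.eq_extFunctor (E X) atil hS.atil_natural (hobj X) (hatil X)
  obtain rfl : @atil = @L.atil := funext fun X => funext fun f => eq_of_heq (hatil X f)
  obtain rfl : @ahat = @L.ahat := by
    funext X Y f g
    exact Iso.ext ((L.isLeftExt _ _).hom_ext ((hS.atil_ahat f g).trans (L.atil_ahat f g).symm))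
  rfl

end Correspondence

end RelativePseudomonad

namespace RelativePseudomonad

variable {𝒜 : Type u₁} [Bicategory.{w₁, v₁} 𝒜] {ℰ : Type u₂} [Bicategory.{w₂, v₂} ℰ]

variable {J : Pseudofunctor 𝒜 ℰ} (T : RelativePseudomonad J)

/-- For every object `A` of `ℰ` there is a bijection between left
extension `T`-pseudoalgebra structures and lax-idempotent `T`-pseudoalgebra structures:
every left extension pseudoalgebra induces a unique lax-idempotent pseudoalgebra with the
same extensions and unit 2-cells, whose `â_{g,f}` is the unique 2-cell whose transpose
along `i_X` is `g^a η_f`; and conversely every lax-idempotent pseudoalgebra arises from a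
unique left extension pseudoalgebra in this way. -/
theorem leftExtAlg_equiv_laxIdempotent (C : ℰ) :
    (∀ L : T.LeftExtAlg C,
      ∃! S : T.AlgData C,
        S.Laws ∧ IsLaxIdempotent S ∧
        (∀ (X : 𝒜) (f : J.obj X ⟶ C), (S.ext X).obj f = L.ext1 X f) ∧
        (∀ (X : 𝒜) (f : J.obj X ⟶ C), HEq (S.atil f) (L.atil f)) ∧
        (∀ {X Y : 𝒜} (f : J.obj X ⟶ T.obj Y) (g : J.obj Y ⟶ C),
          (S.atil (f ≫ (S.ext Y).obj g)).hom ≫ T.unit X ◁ (S.ahat f g).hom =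
            (T.eta f).hom ▷ (S.ext Y).obj g ≫
              (α_ (T.unit X) (T.ext.obj f) ((S.ext Y).obj g)).hom)) ∧
    (∀ S : T.AlgData C, S.Laws → IsLaxIdempotent S →
      ∃! L : T.LeftExtAlg C,
        (∀ (X : 𝒜) (f : J.obj X ⟶ C), L.ext1 X f = (S.ext X).obj f) ∧
        (∀ (X : 𝒜) (f : J.obj X ⟶ C), HEq (L.atil f) (S.atil f))) := by
  refine ⟨fun L => ⟨L.toAlgData, ⟨L.toAlgData_laws, L.toAlgData_isLaxIdempotent,
    fun _ _ => rfl, fun _ _ => HEq.rfl, L.atil_ahat⟩, ?_⟩, fun S hS hS' =>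
    ⟨S.toLeftExtAlg hS hS', ⟨fun _ _ => rfl, fun _ _ => HEq.rfl⟩, ?_⟩⟩
  · rintro S ⟨hS, -, hobj, hatil, -⟩
    exact L.eq_toAlgData hS hobj hatil
  · rintro L ⟨hobj, hatil⟩
    exact LeftExtAlg.ext_of_heq hobj hatil

end RelativePseudomonad
end

section
/- Let ℰ be a bicategory and T a pseudomonad on ℰ presented in extension form, i.e. a relative pseudomonad with J the identity pseudofunctor of ℰ. A T-pseudoalgebra (A, (-)^a, â, ã) is a lax fixed point — meaning that ã_{1_A}⁻¹ : (1_A)^a ∘ i_A ⇒ 1_A is the counit of an adjunction (1_A)^a ⊣ i_A in ℰ — if and only if, for every T-pseudoalgebra (B, (-)^b, b̂, b̃), every 1-cell g : A → B of ℰ admits exactly one lax morphism structure. Moreover, in that case, the forgetful functor from the category of lax morphisms (A, (-)^a, â, ã) → (B, (-)^b, b̂, b̃) and transformations to ℰ[A, B] is fully faithful. -/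
open CategoryTheory Bicategory

universe w₁ v₁ u₁ w₂ v₂ u₂

namespace RelativePseudomonad

variable {ℰ : Type u₂} [Bicategory.{w₂, v₂} ℰ]

/-- A pseudoalgebra for a pseudomonad (in extension form, i.e. a pseudomonad relative to
the identity pseudofunctor) is a lax fixed point when `ã_{1_A}⁻¹` is the counit of an
adjunction `(1_A)^a ⊣ i_A` in `ℰ`. -/
def IsLaxFixedPoint {T : RelativePseudomonad (Pseudofunctor.id ℰ)} {C : ℰ}
    (S : T.AlgData C) : Prop :=
  ∃ adj : Bicategory.Adjunction ((S.ext C).obj (𝟙 C)) (T.unit C),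
    adj.counit = (S.atil (𝟙 C)).inv

section Derived

variable {𝒜 : Type u₁} [Bicategory.{w₁, v₁} 𝒜] {𝒦 : Type u₂} [Bicategory.{w₂, v₂} 𝒦]
  {J : Pseudofunctor 𝒜 𝒦} {T : RelativePseudomonad J} {C : 𝒦} {S : T.AlgData C}

namespace AlgData.Laws

theorem ext_map_injective_s11 (hS : S.Laws) {X : 𝒜} {f g : J.obj X ⟶ C} {α β : f ⟶ g}
    (h : (S.ext X).map α = (S.ext X).map β) : α = β := by
  rw [← cancel_mono (S.atil g).hom, hS.atil_natural, hS.atil_natural, h]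

theorem ahat_natural_left (hS : S.Laws) {X Y : 𝒜} {f f' : J.obj X ⟶ T.obj Y} (α : f ⟶ f')
    (g : J.obj Y ⟶ C) :
    (S.ext X).map (α ▷ (S.ext Y).obj g) ≫ (S.ahat f' g).hom =
      (S.ahat f g).hom ≫ T.ext.map α ▷ (S.ext Y).obj g := by
  simpa using hS.ahat_natural α (𝟙 g)

theorem ahat_natural_right (hS : S.Laws) {X Y : 𝒜} (f : J.obj X ⟶ T.obj Y)
    {g g' : J.obj Y ⟶ C} (β : g ⟶ g') :
    (S.ext X).map (f ◁ (S.ext Y).map β) ≫ (S.ahat f g').hom =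
      (S.ahat f g).hom ≫ T.ext.obj f ◁ (S.ext Y).map β := by
  simpa using hS.ahat_natural (𝟙 f) β

theorem unit_eq_id (hS : S.Laws) {X : 𝒜} (f : J.obj X ⟶ C) :
    (S.ext X).map (S.atil f).hom ≫ (S.ahat (T.unit X) f).hom ≫
      (T.theta X).hom ▷ (S.ext X).obj f ≫ (λ_ ((S.ext X).obj f)).hom = 𝟙 _ := by
  rw [← cancel_mono (λ_ ((S.ext X).obj f)).inv]
  simpa using hS.unit f

theorem atil_ahat_s11 (hS : S.Laws) {X Y : 𝒜} (f : J.obj X ⟶ T.obj Y) (g : J.obj Y ⟶ C) :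
    (S.atil (f ≫ (S.ext Y).obj g)).hom ≫ T.unit X ◁ (S.ahat f g).hom =
      (T.eta f).hom ▷ (S.ext Y).obj g ≫ (α_ _ _ _).hom := by
  apply hS.ext_map_injective_s11
  have hA : (S.ext X).map ((S.atil (f ≫ (S.ext Y).obj g)).hom ≫ T.unit X ◁ (S.ahat f g).hom) ≫
      (S.ext X).map (α_ (T.unit X) (T.ext.obj f) ((S.ext Y).obj g)).inv ≫
      (S.ahat (T.unit X ≫ T.ext.obj f) g).hom ≫ (T.mul (T.unit X) f).hom ▷ (S.ext Y).obj g ≫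
      ((T.theta X).hom ▷ T.ext.obj f) ▷ (S.ext Y).obj g ≫
      (λ_ (T.ext.obj f)).hom ▷ (S.ext Y).obj g = (S.ahat f g).hom := by
    have h := hS.assoc (T.unit X) f g
    have e : ((T.theta X).hom ▷ T.ext.obj f) ▷ (S.ext Y).obj g ≫
        (λ_ (T.ext.obj f)).hom ▷ (S.ext Y).obj g =
        (α_ _ _ _).hom ≫ (T.theta X).hom ▷ (T.ext.obj f ≫ (S.ext Y).obj g) ≫ (λ_ _).hom := by
      bicategory
    rw [e, Functor.map_comp, Category.assoc]
    have h' := h =≫ ((T.theta X).hom ▷ (T.ext.obj f ≫ (S.ext Y).obj g) ≫ (λ_ _).hom)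
    simp only [Category.assoc] at h'
    rw [← h', whisker_exchange_assoc, leftUnitor_naturality,
      reassoc_of% hS.unit_eq_id (f ≫ (S.ext Y).obj g)]
  have hB : (S.ext X).map ((T.eta f).hom ▷ (S.ext Y).obj g ≫ (α_ _ _ _).hom) ≫
      (S.ext X).map (α_ (T.unit X) (T.ext.obj f) ((S.ext Y).obj g)).inv ≫
      (S.ahat (T.unit X ≫ T.ext.obj f) g).hom ≫ (T.mul (T.unit X) f).hom ▷ (S.ext Y).obj g ≫
      ((T.theta X).hom ▷ T.ext.obj f) ▷ (S.ext Y).obj g ≫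
      (λ_ (T.ext.obj f)).hom ▷ (S.ext Y).obj g = (S.ahat f g).hom := by
    rw [← Functor.map_comp_assoc, Category.assoc, Iso.hom_inv_id, Category.comp_id,
      reassoc_of% hS.ahat_natural_left]
    have h : T.ext.map (T.eta f).hom ≫ (T.mul (T.unit X) f).hom ≫
        (T.theta X).hom ▷ T.ext.obj f ≫ (λ_ (T.ext.obj f)).hom = 𝟙 _ :=
      (T.freeAlgData_laws Y).unit_eq_id f
    simp only [← comp_whiskerRight]
    rw [h]
    simp
  exact (cancel_mono _).1 (hA.trans hB.symm)

end AlgData.Laws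

theorem mul_natural_left (T : RelativePseudomonad J) {X Y Z : 𝒜} {f f' : J.obj X ⟶ T.obj Y}
    (α : f ⟶ f') (g : J.obj Y ⟶ T.obj Z) :
    T.ext.map (α ▷ T.ext.obj g) ≫ (T.mul f' g).hom =
      (T.mul f g).hom ≫ T.ext.map α ▷ T.ext.obj g :=
  (T.freeAlgData_laws Z).ahat_natural_left α g

theorem mul_natural_right (T : RelativePseudomonad J) {X Y Z : 𝒜} (f : J.obj X ⟶ T.obj Y)
    {g g' : J.obj Y ⟶ T.obj Z} (β : g ⟶ g') :
    T.ext.map (f ◁ T.ext.map β) ≫ (T.mul f g').hom =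
      (T.mul f g).hom ≫ T.ext.obj f ◁ T.ext.map β :=
  (T.freeAlgData_laws Z).ahat_natural_right f β

theorem mul_whiskerLeft_theta (T : RelativePseudomonad J) {X Y : 𝒜} (f : J.obj X ⟶ T.obj Y) :
    T.ext.map ((ρ_ f).inv ≫ f ◁ (T.theta Y).inv) ≫ (T.mul f (T.unit Y)).hom ≫
      T.ext.obj f ◁ (T.theta Y).hom ≫ (ρ_ _).hom = 𝟙 _ := by
  have key : (T.ext.map ((ρ_ f).inv ≫ f ◁ (T.theta Y).inv) ≫ (T.mul f (T.unit Y)).hom ≫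
      T.ext.obj f ◁ (T.theta Y).hom ≫ (ρ_ _).hom) ▷ T.ext.obj (T.unit Y) = 𝟙 _ := by
    have hu : T.ext.map (T.eta (T.unit Y)).hom ≫ (T.mul (T.unit Y) (T.unit Y)).hom =
        (λ_ _).inv ≫ (T.theta Y).inv ▷ T.ext.obj (T.unit Y) := by
      rw [← cancel_mono ((T.theta Y).hom ▷ T.ext.obj (T.unit Y))]
      simpa using T.unit_law (T.unit Y)
    have h := T.ext.map (f ◁ T.ext.map (T.eta (T.unit Y)).hom) ≫= T.assoc f (T.unit Y) (T.unit Y)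
    rw [reassoc_of% T.mul_natural_right, ← Functor.map_comp_assoc, ← Bicategory.whiskerLeft_comp,
      ← Bicategory.whiskerLeft_comp, hu, ← Functor.map_comp_assoc] at h
    have e : f ◁ ((λ_ _).inv ≫ (T.theta Y).inv ▷ T.ext.obj (T.unit Y)) ≫ (α_ _ _ _).inv =
        ((ρ_ f).inv ≫ f ◁ (T.theta Y).inv) ▷ T.ext.obj (T.unit Y) := by
      simp
    rw [e, reassoc_of% T.mul_natural_left, cancel_epi] at h
    have h' := h =≫ (T.ext.obj f ◁ (T.theta Y).hom ▷ T.ext.obj (T.unit Y) ≫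
      T.ext.obj f ◁ (λ_ _).hom)
    simp only [Category.assoc, ← Bicategory.whiskerLeft_comp, inv_hom_whiskerRight_assoc,
      Iso.inv_hom_id] at h'
    rw [Bicategory.whiskerLeft_id] at h'
    rw [h']
    simp
  have e := congrArg (fun t => (ρ_ _).inv ≫ T.ext.obj f ◁ (T.theta Y).inv ≫ t ≫
    T.ext.obj f ◁ (T.theta Y).hom ≫ (ρ_ _).hom) key
  simpa only [whisker_exchange_assoc, Category.id_comp, whiskerLeft_inv_hom_assoc,
    rightUnitor_naturality, Iso.inv_hom_id_assoc, Iso.inv_hom_id] using e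

theorem eta_unit_theta (T : RelativePseudomonad J) (X : 𝒜) :
    (T.eta (T.unit X)).hom ≫ T.unit X ◁ (T.theta X).hom = (ρ_ (T.unit X)).inv := by
  rw [← cancel_mono (T.unit X ◁ (T.theta X).inv), Category.assoc, whiskerLeft_hom_inv,
    Category.comp_id]
  apply (T.freeAlgData_laws X).ext_map_injective_s11
  change T.ext.map _ = T.ext.map _
  have e : (T.theta X).hom ▷ T.ext.obj (T.unit X) ≫ (λ_ _).hom =
      T.ext.obj (T.unit X) ◁ (T.theta X).hom ≫ (ρ_ _).hom := by
    rw [← cancel_mono (T.theta X).hom, Category.assoc, Category.assoc,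
      ← leftUnitor_naturality, ← rightUnitor_naturality, ← whisker_exchange_assoc,
      unitors_equal]
  rw [← cancel_mono ((T.mul (T.unit X) (T.unit X)).hom ≫
    (T.theta X).hom ▷ T.ext.obj (T.unit X) ≫ (λ_ _).hom)]
  refine ((T.freeAlgData_laws X).unit_eq_id (T.unit X)).trans ?_
  rw [e, mul_whiskerLeft_theta]
  rfl

end Derived
section LaxMorphisms

variable {𝒜 : Type u₁} [Bicategory.{w₁, v₁} 𝒜] {𝒦 : Type u₂} [Bicategory.{w₂, v₂} 𝒦]
  {J : Pseudofunctor 𝒜 𝒦} {T : RelativePseudomonad J} {C C' C'' : 𝒦} {S : T.AlgData C}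
  {S' : T.AlgData C'} {S'' : T.AlgData C''}

theorem idLaxData_isLaxMorphism (hS : S.Laws) : (idLaxData S).IsLaxMorphism where
  natural α := by
    dsimp only [idLaxData]
    rw [← Functor.map_comp_assoc, Category.assoc, ← rightUnitor_inv_naturality,
      ← Functor.map_comp_assoc, rightUnitor_naturality]
  unit f := by
    dsimp only [idLaxData]
    rw [Bicategory.whiskerLeft_comp, ← reassoc_of% hS.atil_natural]
    simp
  assoc f g := by
    dsimp only [idLaxData]
    have h := hS.ahat_natural_right f (ρ_ g).hom
    have e : (S.ext _).map (f ◁ ((S.ext _).map (ρ_ g).hom ≫ (ρ_ _).inv)) ≫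
        (S.ext _).map (α_ f ((S.ext _).obj g) (𝟙 _)).inv ≫ (S.ext _).map (ρ_ _).hom =
        (S.ext _).map (f ◁ (S.ext _).map (ρ_ g).hom) := by
      rw [← Functor.map_comp, ← Functor.map_comp]
      congr 1
      simp
    simp only [Category.assoc]
    rw [reassoc_of% e, ← rightUnitor_inv_naturality, reassoc_of% h]
    simp

theorem compLaxData_isLaxMorphism {m : LaxData S S'} {n : LaxData S' S''}
    (hS'' : S''.Laws) (hm : m.IsLaxMorphism) (hn : n.IsLaxMorphism) :
    (compLaxData m n).IsLaxMorphism where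
  natural {X f f'} α := by
    dsimp only [compLaxData]
    have h₁ := hn.natural (α ▷ m.hom)
    have h₂ := hm.natural α
    rw [← Functor.map_comp_assoc, associator_inv_naturality_left, Functor.map_comp_assoc,
      reassoc_of% h₁, ← comp_whiskerRight_assoc, h₂]
    simp
  unit {X} f := by
    dsimp only [compLaxData]
    have h₁ := hn.unit (f ≫ m.hom)
    have h₂ := hm.unit f
    rw [Bicategory.whiskerLeft_comp, ← reassoc_of% hS''.atil_natural,
      Bicategory.whiskerLeft_comp, reassoc_of% h₁, Bicategory.whiskerLeft_comp,
      ← associator_naturality_middle_assoc, ← comp_whiskerRight_assoc, h₂]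
    simp
  assoc {X Y} f g := by
    dsimp only [compLaxData]
    have h₁ := hn.assoc f (g ≫ m.hom)
    have h₂ := hm.assoc f g
    have h₃ := hn.natural (f ◁ m.lax Y g)
    have h₄ := hn.natural (α_ f ((S.ext Y).obj g) m.hom).inv
    have h₅ := hS''.ahat_natural_right f (α_ g m.hom n.hom).inv
    have e₁ : T.ext.obj f ◁ n.lax Y (g ≫ m.hom) ≫ T.ext.obj f ◁ m.lax Y g ▷ n.hom ≫
        T.ext.obj f ◁ (α_ _ _ _).hom ≫ (α_ _ _ _).inv =
        (T.ext.obj f ◁ n.lax Y (g ≫ m.hom) ≫ (α_ _ _ _).inv) ≫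
          (T.ext.obj f ◁ m.lax Y g ≫ (α_ _ _ _).inv) ▷ n.hom ≫ (α_ _ _ _).hom := by
      simp
    have e₂ : f ◁ (S''.ext Y).map (α_ g m.hom n.hom).inv ≫ f ◁ n.lax Y (g ≫ m.hom) ≫
        (α_ _ _ _).inv ≫ (f ◁ m.lax Y g) ▷ n.hom ≫ (α_ _ _ _).inv ▷ n.hom =
        f ◁ ((S''.ext Y).map (α_ g m.hom n.hom).inv ≫ n.lax Y (g ≫ m.hom) ≫
          m.lax Y g ▷ n.hom ≫ (α_ _ _ _).hom) ≫ (α_ _ _ _).inv ≫ (α_ _ _ _).inv := by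
      simp
    have e₃ := congrArg (S''.ext X).map e₂
    simp only [Functor.map_comp] at e₃
    simp only [Bicategory.whiskerLeft_comp, Category.assoc] at e₃ ⊢
    rw [← reassoc_of% h₅, e₁]
    simp only [Category.assoc]
    rw [reassoc_of% h₁, ← comp_whiskerRight_assoc, h₂]
    simp only [comp_whiskerRight, Category.assoc]
    rw [← reassoc_of% h₃, ← reassoc_of% h₄, reassoc_of% e₃, associator_naturality_left]

/-- Transport of lax morphism data along an invertible 2-cell. -/
def LaxData.transport (m : LaxData S S') {g : C ⟶ C'} (e : m.hom ≅ g) : LaxData S S' where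
  hom := g
  lax X f := (S'.ext X).map (f ◁ e.inv) ≫ m.lax X f ≫ (S.ext X).obj f ◁ e.hom

theorem LaxData.IsLaxMorphism.transport (hS' : S'.Laws) {m : LaxData S S'} (hm : m.IsLaxMorphism)
    {g : C ⟶ C'} (e : m.hom ≅ g) : (m.transport e).IsLaxMorphism where
  natural {X f f'} α := by
    dsimp only [LaxData.transport]
    have h := hm.natural α
    rw [← Functor.map_comp_assoc, ← whisker_exchange, Functor.map_comp_assoc, reassoc_of% h]
    simp only [Category.assoc, whisker_exchange]
  unit {X} f := by
    dsimp only [LaxData.transport]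
    have h := hm.unit f
    rw [Bicategory.whiskerLeft_comp, ← reassoc_of% hS'.atil_natural,
      Bicategory.whiskerLeft_comp, reassoc_of% h]
    rw [← associator_naturality_right, ← whisker_exchange_assoc, whiskerLeft_inv_hom_assoc]
  assoc {X Y} f g := by
    dsimp only [LaxData.transport]
    have h₁ := hm.assoc f g
    have h₂ := hS'.ahat_natural_right f (g ◁ e.inv)
    have e₁ : f ◁ (S'.ext Y).map (g ◁ e.inv) ≫ f ◁ m.lax Y g ≫ (α_ _ _ _).inv =
        f ◁ ((S'.ext Y).map (g ◁ e.inv) ≫ m.lax Y g ≫ (S.ext Y).obj g ◁ e.hom) ≫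
          (α_ _ _ _).inv ≫ (f ≫ (S.ext Y).obj g) ◁ e.inv := by
      simp
    have e₂ := congrArg (S'.ext X).map e₁
    simp only [Functor.map_comp] at e₂
    simp only [Bicategory.whiskerLeft_comp, Category.assoc] at e₂ ⊢
    rw [← reassoc_of% h₂, associator_inv_naturality_right, reassoc_of% h₁, reassoc_of% e₂,
      whisker_exchange]

/-- The extension of a 1-cell into a pseudoalgebra, with its canonical lax comparison
2-cells as a morphism out of the free pseudoalgebra. -/
def extLaxData (S : T.AlgData C) {Y : 𝒜} (g : J.obj Y ⟶ C) : LaxData (T.freeAlgData Y) S where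
  hom := (S.ext Y).obj g
  lax _ f := (S.ahat f g).hom

theorem extLaxData_isLaxMorphism (hS : S.Laws) {Y : 𝒜} (g : J.obj Y ⟶ C) :
    (extLaxData S g).IsLaxMorphism where
  natural α := hS.ahat_natural_left α g
  unit f := hS.atil_ahat_s11 f g
  assoc f h := by
    have h₁ := hS.assoc f h g
    dsimp only [extLaxData, freeAlgData] at h₁ ⊢
    rw [reassoc_of% h₁]
    simp

/-- The inverse comparison 2-cells exhibit the extension of a 1-cell as a colax morphism. -/
def extColaxData (S : T.AlgData C) {Y : 𝒜} (g : J.obj Y ⟶ C) :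
    ColaxData (T.freeAlgData Y) S where
  hom := (S.ext Y).obj g
  colax _ f := (S.ahat f g).inv

theorem extColaxData_isColaxMorphism (hS : S.Laws) {Y : 𝒜} (g : J.obj Y ⟶ C) :
    (extColaxData S g).IsColaxMorphism where
  natural {X f f'} α := by
    dsimp only [extColaxData, freeAlgData]
    rw [Iso.inv_comp_eq, ← reassoc_of% hS.ahat_natural_left, Iso.hom_inv_id, Category.comp_id]
  unit {X} f := by
    dsimp only [extColaxData, freeAlgData]
    rw [← reassoc_of% hS.atil_ahat_s11, whiskerLeft_hom_inv, Category.comp_id]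
  assoc {X Z} f h := by
    have h₁ := hS.assoc f h g
    dsimp only [extColaxData, freeAlgData] at h₁ ⊢
    rw [← cancel_epi (S.ahat (f ≫ T.ext.obj h) g).hom, Iso.hom_inv_id_assoc,
      ← cancel_epi ((S.ext X).map (α_ f (T.ext.obj h) ((S.ext Y).obj g)).inv),
      ← cancel_epi ((S.ext X).map (f ◁ (S.ahat h g).hom)), ← reassoc_of% h₁,
      whiskerLeft_hom_inv, Category.comp_id]
    simp only [← Functor.map_comp_assoc, Iso.inv_hom_id_assoc, whiskerLeft_hom_inv]
    rw [CategoryTheory.Functor.map_id, Category.id_comp]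

section Mates

variable {l : C ⟶ C'} {r : C' ⟶ C} (adj : Bicategory.Adjunction l r)

theorem nuW_naturality {a : 𝒦} {f f' : a ⟶ C} (α : f ⟶ f') :
    α ≫ nuW adj f' = nuW adj f ≫ α ▷ l ▷ r := by
  simp only [nuW, Category.assoc]
  rw [rightUnitor_inv_naturality_assoc, ← whisker_exchange_assoc,
    associator_inv_naturality_left]

theorem epsW_naturality {a : 𝒦} {g g' : a ⟶ C'} (α : g ⟶ g') :
    α ▷ r ▷ l ≫ epsW adj g' = epsW adj g ≫ α := by
  simp only [epsW, Category.assoc]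
  rw [associator_naturality_left_assoc, ← whisker_exchange_assoc, rightUnitor_naturality]

theorem whiskerLeft_nuW {a b : 𝒦} (f : a ⟶ b) (g : b ⟶ C) :
    f ◁ nuW adj g = nuW adj (f ≫ g) ≫ (α_ f g l).hom ▷ r ≫ (α_ f (g ≫ l) r).hom := by
  simp [nuW]

theorem whiskerLeft_epsW {a b : 𝒦} (f : a ⟶ b) (g : b ⟶ C') :
    f ◁ epsW adj g =
      (α_ f (g ≫ r) l).inv ≫ (α_ f g r).inv ▷ l ≫ epsW adj (f ≫ g) := by
  simp [epsW]

theorem nuW_epsW_whiskerRight {a : 𝒦} (g : a ⟶ C') :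
    nuW adj (g ≫ r) ≫ epsW adj g ▷ r = 𝟙 _ := by
  calc
    _ = 𝟙 _ ⊗≫ g ◁ rightZigzag adj.unit adj.counit ⊗≫ 𝟙 _ := by
      simp only [nuW, epsW, rightZigzag]
      bicategory
    _ = _ := by
      rw [adj.right_triangle]
      bicategory

theorem nuW_whiskerRight_epsW {a : 𝒦} (f : a ⟶ C) :
    nuW adj f ▷ l ≫ epsW adj (f ≫ l) = 𝟙 _ := by
  calc
    _ = 𝟙 _ ⊗≫ f ◁ leftZigzag adj.unit adj.counit ⊗≫ 𝟙 _ := by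
      simp only [nuW, epsW, leftZigzag]
      bicategory
    _ = _ := by
      rw [adj.left_triangle]
      bicategory

theorem laxMate_eq
    (lc : ∀ (X : 𝒜) (f : J.obj X ⟶ C), (S.ext X).obj f ≫ l ⟶ (S'.ext X).obj (f ≫ l))
    (X : 𝒜) (g : J.obj X ⟶ C') :
    laxMate adj lc X g =
      nuW adj _ ≫ lc X (g ≫ r) ▷ r ≫ (S'.ext X).map (epsW adj g) ▷ r := by
  simp [laxMate, nuW]

theorem laxMate_whiskerRight_epsW
    (lc : ∀ (X : 𝒜) (f : J.obj X ⟶ C), (S.ext X).obj f ≫ l ⟶ (S'.ext X).obj (f ≫ l))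
    (X : 𝒜) (g : J.obj X ⟶ C') :
    laxMate adj lc X g ▷ l ≫ epsW adj _ = lc X (g ≫ r) ≫ (S'.ext X).map (epsW adj g) := by
  rw [laxMate_eq]
  simp only [comp_whiskerRight, Category.assoc]
  rw [epsW_naturality, reassoc_of% epsW_naturality, reassoc_of% nuW_whiskerRight_epsW]

end Mates

theorem laxMate_isLaxMorphism (hS' : S'.Laws) (m : ColaxData S S')
    (hm : m.IsColaxMorphism) {r : C' ⟶ C} (adj : Bicategory.Adjunction m.hom r) :
    (⟨r, laxMate adj m.colax⟩ : LaxData S' S).IsLaxMorphism where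
  natural {X f f'} α := by
    have h := hm.natural (α ▷ r)
    dsimp only
    rw [laxMate_eq, laxMate_eq, ← Category.assoc, nuW_naturality]
    simp only [Category.assoc, ← comp_whiskerRight]
    rw [← reassoc_of% h, ← Functor.map_comp, epsW_naturality, Functor.map_comp]
  unit {X} f := by
    have h := hm.unit (f ≫ r)
    dsimp only
    rw [laxMate_eq, Bicategory.whiskerLeft_comp, whiskerLeft_nuW]
    simp only [Category.assoc, Bicategory.whiskerLeft_comp]
    rw [reassoc_of% nuW_naturality, ← associator_naturality_middle_assoc,
      ← comp_whiskerRight_assoc, ← comp_whiskerRight_assoc, Category.assoc, h,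
      ← associator_naturality_middle, ← comp_whiskerRight_assoc, ← hS'.atil_natural,
      comp_whiskerRight_assoc, reassoc_of% nuW_epsW_whiskerRight]
  assoc {X Y} f g := by
    have h := hm.assoc f (g ≫ r)
    have hn := hm.natural (f ◁ laxMate adj m.colax Y g ≫ (α_ _ _ _).inv)
    have hr := hS'.ahat_natural_right f (epsW adj g)
    have e₁ : (f ◁ laxMate adj m.colax Y g ≫ (α_ _ _ _).inv) ▷ m.hom ≫ epsW adj _ =
        (α_ _ _ _).hom ≫ f ◁ m.colax Y (g ≫ r) ≫ f ◁ (S'.ext Y).map (epsW adj g) := by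
      rw [← Bicategory.whiskerLeft_comp, ← laxMate_whiskerRight_epsW,
        Bicategory.whiskerLeft_comp, whiskerLeft_epsW]
      simp
    have e₂ := congrArg (S'.ext X).map e₁
    simp only [Functor.map_comp] at e₂ hn
    dsimp only
    have hL : T.ext.obj f ◁ laxMate adj m.colax Y g =
        nuW adj _ ≫ ((α_ _ _ _).hom ≫ T.ext.obj f ◁ m.colax Y (g ≫ r) ≫
          T.ext.obj f ◁ (S'.ext Y).map (epsW adj g)) ▷ r ≫ (α_ _ _ _).hom := by
      rw [laxMate_eq, Bicategory.whiskerLeft_comp, whiskerLeft_nuW]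
      simp
    have hR : ((S.ext X).map (f ◁ laxMate adj m.colax Y g) ≫
        (S.ext X).map (α_ _ _ _).inv) ≫ laxMate adj m.colax X (f ≫ (S'.ext Y).obj g) =
        nuW adj _ ≫ (m.colax X _ ≫ (S'.ext X).map (α_ _ _ _).hom ≫
          (S'.ext X).map (f ◁ m.colax Y (g ≫ r)) ≫
          (S'.ext X).map (f ◁ (S'.ext Y).map (epsW adj g))) ▷ r := by
      rw [laxMate_eq _ _ _ (f ≫ _), reassoc_of% nuW_naturality, ← comp_whiskerRight,
        ← comp_whiskerRight, ← reassoc_of% hn, e₂]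
    simp only [Category.assoc] at hR
    rw [reassoc_of% hR, hL]
    simp only [Category.assoc, Iso.hom_inv_id, Category.comp_id]
    rw [reassoc_of% nuW_naturality, ← comp_whiskerRight, ← comp_whiskerRight, reassoc_of% h,
      ← hr]
    simp only [Category.assoc]

end LaxMorphisms
section FixedPoint

variable {𝒜 : Type u₁} [Bicategory.{w₁, v₁} 𝒜] {𝒦 : Type u₂} [Bicategory.{w₂, v₂} 𝒦]
  {J : Pseudofunctor 𝒜 𝒦} {T : RelativePseudomonad J} {Y : 𝒜} {S : T.AlgData (J.obj Y)}
  {C' : 𝒦} {S' : T.AlgData C'}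

/-- Whiskering with the right adjoint is injective on 2-cells into 1-cells that factor
through the left adjoint. -/
theorem eq_of_whiskerLeft_eq {a b c : 𝒦} {l : a ⟶ b} {r : b ⟶ a}
    (adj : Bicategory.Adjunction l r) {p : a ⟶ c} {q : b ⟶ c} {x y : p ⟶ l ≫ q}
    (h : r ◁ x = r ◁ y) : x = y := by
  have key (z : p ⟶ l ≫ q) : z = (λ_ p).inv ≫ adj.unit ▷ p ≫ (α_ _ _ _).hom ≫
      l ◁ r ◁ z ≫ l ◁ ((α_ _ _ _).inv ≫ adj.counit ▷ q ≫ (λ_ q).hom) := by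
    calc
      z = (λ_ p).inv ≫ 𝟙 a ◁ z ≫ (λ_ (l ≫ q)).hom := by simp
      _ = (λ_ p).inv ≫ 𝟙 a ◁ z ⊗≫ leftZigzag adj.unit adj.counit ▷ q ⊗≫ 𝟙 _ := by
        rw [adj.left_triangle]
        bicategory
      _ = (λ_ p).inv ≫ (𝟙 a ◁ z ≫ adj.unit ▷ (l ≫ q)) ⊗≫ l ◁ adj.counit ▷ q ⊗≫ 𝟙 _ := by
        simp only [leftZigzag]
        bicategory
      _ = _ := by
        rw [whisker_exchange]
        bicategory
  rw [key x, key y, h]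

theorem isTransformation_of_adjunction
    (adj : Bicategory.Adjunction ((S.ext Y).obj (𝟙 (J.obj Y))) (T.unit Y))
    (hS' : S'.Laws)
    {m m' : LaxData S S'} (hm : m.IsLaxMorphism) (hm' : m'.IsLaxMorphism)
    (α : m.hom ⟶ m'.hom) : IsTransformation m m' α := by
  have h₁ : (S'.ext Y).map (𝟙 _ ◁ α) ≫ m'.lax Y (𝟙 _) =
      m.lax Y (𝟙 _) ≫ (S.ext Y).obj (𝟙 _) ◁ α := by
    apply eq_of_whiskerLeft_eq adj
    rw [← cancel_epi (S'.atil (𝟙 _ ≫ m.hom)).hom, Bicategory.whiskerLeft_comp,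
      Bicategory.whiskerLeft_comp, ← reassoc_of% hS'.atil_natural, hm'.unit,
      reassoc_of% hm.unit, whisker_exchange_assoc, associator_naturality_right]
  have hiso : IsIso (T.unit Y ◁ m.lax Y (𝟙 _)) := by
    have h := hm.unit (𝟙 (J.obj Y))
    rw [← Iso.eq_inv_comp] at h
    rw [h]
    infer_instance
  have h₂ {X : 𝒜} (k : J.obj X ⟶ J.obj Y) :
      (S'.ext X).map (((k ≫ T.unit Y) ≫ (S.ext Y).obj (𝟙 _)) ◁ α) ≫ m'.lax X _ =
        m.lax X _ ≫ (S.ext X).obj ((k ≫ T.unit Y) ≫ (S.ext Y).obj (𝟙 _)) ◁ α := by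
    set F := k ≫ T.unit Y with hF
    have hisoF : IsIso (F ◁ m.lax Y (𝟙 _)) := by
      rw [hF, comp_whiskerLeft]
      infer_instance
    have ha := hm.assoc F (𝟙 _)
    have ha' := hm'.assoc F (𝟙 _)
    have hn := hS'.ahat_natural_right F (𝟙 (J.obj Y) ◁ α)
    rw [← cancel_epi ((S'.ext X).map (α_ F ((S.ext Y).obj (𝟙 _)) m.hom).inv),
      ← cancel_epi ((S'.ext X).map (F ◁ m.lax Y (𝟙 _))),
      ← cancel_mono ((S.ahat F (𝟙 _)).hom ▷ m'.hom)]
    have e₁ : F ◁ m.lax Y (𝟙 _) ≫ (α_ F ((S.ext Y).obj (𝟙 _)) m.hom).inv ≫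
        (F ≫ (S.ext Y).obj (𝟙 _)) ◁ α =
        F ◁ (S'.ext Y).map (𝟙 _ ◁ α) ≫ F ◁ m'.lax Y (𝟙 _) ≫ (α_ _ _ _).inv := by
      rw [← Bicategory.whiskerLeft_comp_assoc, h₁]
      simp
    have e₂ := congrArg (S'.ext X).map e₁
    simp only [Functor.map_comp] at e₂
    simp only [Category.assoc]
    rw [reassoc_of% e₂, ← ha', reassoc_of% hn, whisker_exchange, ← reassoc_of% ha,
      ← associator_inv_naturality_right, ← Bicategory.whiskerLeft_comp_assoc, h₁]
    simp
  intro X f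
  let s : f ≅ (f ≫ T.unit Y) ≫ (S.ext Y).obj (𝟙 _) :=
    (ρ_ f).symm ≪≫ whiskerLeftIso f (S.atil (𝟙 _)) ≪≫ (α_ _ _ _).symm
  rw [← cancel_mono ((S.ext X).map s.hom ▷ m'.hom), Category.assoc, Category.assoc,
    whisker_exchange, ← hm'.natural, ← reassoc_of% hm.natural, ← h₂,
    ← Functor.map_comp_assoc, ← Functor.map_comp_assoc, whisker_exchange]

theorem exists_isLaxMorphism
    (adj : Bicategory.Adjunction ((S.ext Y).obj (𝟙 (J.obj Y))) (T.unit Y))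
    (hS : S.Laws) (hS' : S'.Laws) (g : J.obj Y ⟶ C') :
    ∃ l : ∀ (X : 𝒜) (f : J.obj X ⟶ J.obj Y),
      (S'.ext X).obj (f ≫ g) ⟶ (S.ext X).obj f ≫ g, (⟨g, l⟩ : LaxData S S').IsLaxMorphism :=
  ⟨_, (compLaxData_isLaxMorphism hS'
    (laxMate_isLaxMorphism hS (extColaxData S (𝟙 _)) (extColaxData_isColaxMorphism hS _) adj)
    (extLaxData_isLaxMorphism hS' g)).transport hS' (S'.atil g).symm⟩

theorem exists_adjunction_of_isLaxMorphism (hS : S.Laws)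
    (u : ∀ (X : 𝒜) (f : J.obj X ⟶ J.obj Y),
      T.ext.obj (f ≫ T.unit Y) ⟶ (S.ext X).obj f ≫ T.unit Y)
    (hu : (⟨T.unit Y, u⟩ : LaxData S (T.freeAlgData Y)).IsLaxMorphism)
    (huniq : ∀ l l' : ∀ (X : 𝒜) (f : J.obj X ⟶ J.obj Y),
      (S.ext X).obj (f ≫ 𝟙 (J.obj Y)) ⟶ (S.ext X).obj f ≫ 𝟙 (J.obj Y),
      (⟨𝟙 _, l⟩ : LaxData S S).IsLaxMorphism → (⟨𝟙 _, l'⟩ : LaxData S S).IsLaxMorphism → l = l') :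
    ∃ adj : Bicategory.Adjunction ((S.ext Y).obj (𝟙 (J.obj Y))) (T.unit Y),
      adj.counit = (S.atil (𝟙 (J.obj Y))).inv := by
  have h := congrFun (congrFun (huniq _ _ (idLaxData_isLaxMorphism hS)
    ((compLaxData_isLaxMorphism hS hu (extLaxData_isLaxMorphism hS (𝟙 (J.obj Y)))).transport hS
      (S.atil (𝟙 _)).symm)) Y) (𝟙 _)
  have hunit := hu.unit (𝟙 (J.obj Y))
  dsimp only [idLaxData, compLaxData, LaxData.transport, extLaxData, freeAlgData] at h hunit
  refine ⟨⟨(T.theta Y).inv ≫ T.ext.map (λ_ _).inv ≫ u Y (𝟙 _), (S.atil (𝟙 _)).inv, ?_, ?_⟩, rfl⟩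
  · have hu' := hS.unit (𝟙 (J.obj Y)) =≫ ((T.theta Y).inv ▷ _)
    simp only [Category.assoc, hom_inv_whiskerRight, Category.comp_id] at hu'
    have e : (S.atil (𝟙 (J.obj Y))).hom ≫ (λ_ (T.unit Y)).inv ▷ _ =
        (ρ_ _).inv ≫ 𝟙 _ ◁ (S.atil (𝟙 (J.obj Y))).hom ≫ (α_ _ _ _).inv := by
      rw [← unitors_inv_equal, ← leftUnitor_inv_naturality_assoc]
      simp
    have e' := congrArg (S.ext Y).map e
    simp only [Functor.map_comp] at e'
    have h' := (S.ext Y).map (ρ_ (𝟙 (J.obj Y))).inv ≫= h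
    simp only [Iso.map_inv_hom_id_assoc, Iso.symm_inv, Iso.symm_hom, Category.assoc] at h'
    rw [← reassoc_of% e', reassoc_of% hS.ahat_natural_left, reassoc_of% hu'] at h'
    rw [h', leftZigzag]
    simp [bicategoricalComp]
  · have hη : T.unit Y ◁ (T.theta Y).inv = (ρ_ _).hom ≫ (T.eta (T.unit Y)).hom := by
      rw [← cancel_mono (T.unit Y ◁ (T.theta Y).hom), Category.assoc, eta_unit_theta]
      simp
    rw [rightZigzag, Bicategory.whiskerLeft_comp, Bicategory.whiskerLeft_comp, hη]
    simp only [Category.assoc]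
    rw [← reassoc_of% T.eta_natural, hunit]
    simp [bicategoricalComp]

end FixedPoint

/-- Let `T` be a pseudomonad on a bicategory `ℰ` in extension form
(i.e. relative to the identity pseudofunctor).  A `T`-pseudoalgebra `(A, (-)^a, â, ã)` is
a lax fixed point if and only if, for every `T`-pseudoalgebra `(B, (-)^b, b̂, b̃)`, every
1-cell `g : A ⟶ B` admits exactly one lax morphism structure; moreover, in that case, the
forgetful functor from the category of lax morphisms `A → B` and transformations to
`ℰ[A, B]` is fully faithful. -/
theorem laxFixedPoint_iff_unique_lax_structure
    (T : RelativePseudomonad (Pseudofunctor.id ℰ)) {C : ℰ}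
    (S : T.AlgData C) (hS : S.Laws) :
    (IsLaxFixedPoint S ↔
      ∀ {C' : ℰ} (S' : T.AlgData C'), S'.Laws → ∀ g : C ⟶ C',
        ∃! l : ∀ (X : ℰ) (f : (Pseudofunctor.id ℰ).obj X ⟶ C),
            (S'.ext X).obj (f ≫ g) ⟶ (S.ext X).obj f ≫ g,
          (⟨g, l⟩ : LaxData S S').IsLaxMorphism) ∧
    (IsLaxFixedPoint S →
      ∀ {C' : ℰ} (S' : T.AlgData C'), S'.Laws →
        (morForget S S' (fun m => m.IsLaxMorphism)).Full ∧
        (morForget S S' (fun m => m.IsLaxMorphism)).Faithful) := by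
  have transformation (h : IsLaxFixedPoint S) {C' : ℰ} (S' : T.AlgData C') (hS' : S'.Laws)
      {m m' : LaxData S S'} (hm : m.IsLaxMorphism) (hm' : m'.IsLaxMorphism)
      (α : m.hom ⟶ m'.hom) : IsTransformation m m' α := by
    obtain ⟨adj, -⟩ := h
    exact isTransformation_of_adjunction (Y := C) adj hS' hm hm' α
  refine ⟨⟨fun h C' S' hS' g => ?_, fun h => ?_⟩, fun h C' S' hS' => ⟨⟨fun {m m'} α => ?_⟩, ⟨?_⟩⟩⟩
  · obtain ⟨l, hl⟩ : ∃ l : ∀ (X : ℰ) (f : (Pseudofunctor.id ℰ).obj X ⟶ C),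
        (S'.ext X).obj (f ≫ g) ⟶ (S.ext X).obj f ≫ g,
        (⟨g, l⟩ : LaxData S S').IsLaxMorphism := by
      obtain ⟨adj, -⟩ := h
      exact exists_isLaxMorphism (Y := C) adj hS hS' g
    refine ⟨l, hl, fun l' hl' => ?_⟩
    funext X f
    simpa using (transformation h S' hS' hl hl' (𝟙 g) X f)
  · obtain ⟨u, hu, -⟩ := h (T.freeAlgData C) (T.freeAlgData_laws C) (T.unit C)
    exact exists_adjunction_of_isLaxMorphism (Y := C) hS u hu
      fun l l' hl hl' => (h S hS (𝟙 C)).unique hl hl'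
  · exact ⟨⟨α, transformation h S' hS' m.property m'.property α⟩, rfl⟩
  · exact fun h => Subtype.ext h

end RelativePseudomonad
end
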